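/- Let $n \ge 3$. There is a unique $k$-algebra homomorphism $\iota : B_n \to C_{n,1}$ sending the class of $x_{ij}$ to $a_{ij} - a_{i,i+1}$ for all $i \ne j$ (indices mod $n$, so $a_{i,i+1}$ means $a_{n,1}$ when $i=n$). The map $\iota$ is injective and preserves the $\mathbb{Z}^n$-grading, and $C_{n,1}$, regarded as a $\mathbb{Z}^n$-graded $B_n$-module via $\iota$, is isomorphic to $B_n \oplus \bigoplus_{i=1}^{n} \bigoplus_{a \ge 1} B_n(-a e_i)$, where $B_n(-v)$ denotes the graded module $B_n$ with grading shifted so that its degree-$b$ component is the degree-$(b-v)$ component of $B_n$. In particular, $C_{n,1}$ is a free $B_n$-module. -/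

import Mathlib

/-! # Setup

`Bring k n` is the ring `B_n`: the quotient of the polynomial ring over the field `k`
in variables `x i j` (ordered pairs `i ≠ j` in `Fin n`), graded by `deg (x i j) = e i`,
by the ideal generated by the quadrics
`(x i K - x i j)(x j K - x j i) - (x i L - x i j)(x j L - x j i)` (`i,j,K,L` pairwise
distinct) and the variables `x i (i+1)` (indices mod `n`).

`Cn1 k n` is the ring `C_{n,1}`: the quotient of the polynomial ring over `k` in
variables `a i j` (`i ≠ j` in `Fin n`) by the ideal generated by
`a i l * a j l - a i j * a j l - a j i * a i l` (`i,j,l` pairwise distinct).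
-/

/-- The variables `x_{ij}` (ordered pairs `i ≠ j`) of the polynomial ring `S_n`. -/
abbrev BVarT (n : ℕ) := {q : Fin n × Fin n // q.1 ≠ q.2}

/-- The variable `x_{ij}`. -/
noncomputable def xv (k : Type*) [Field k] {n : ℕ} (i j : Fin n) (h : i ≠ j) :
    MvPolynomial (BVarT n) k :=
  MvPolynomial.X (⟨(i, j), h⟩ : BVarT n)

/-- The cyclic successor `i + 1` (mod `n`) of an index `i`. -/
def nextIdx {n : ℕ} (i : Fin n) : Fin n := ⟨(i.val + 1) % n, Nat.mod_lt _ i.pos⟩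

/-- The defining relations of `B_n`: the quadrics and the variables `x i (i+1)`
(indices mod `n`). -/
def Brels (k : Type*) [Field k] (n : ℕ) : Set (MvPolynomial (BVarT n) k) :=
  {f | ∃ (i j K L : Fin n) (hij : i ≠ j) (hiK : i ≠ K) (hiL : i ≠ L)
        (hjK : j ≠ K) (hjL : j ≠ L) (_ : K ≠ L),
      f = (xv k i K hiK - xv k i j hij) * (xv k j K hjK - xv k j i hij.symm)
            - (xv k i L hiL - xv k i j hij) * (xv k j L hjL - xv k j i hij.symm)} ∪
  {f | ∃ (i : Fin n) (h : i ≠ nextIdx i), f = xv k i (nextIdx i) h}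

/-- The ring `B_n`. -/
abbrev Bring (k : Type*) [Field k] (n : ℕ) :=
  MvPolynomial (BVarT n) k ⧸ Ideal.span (Brels k n)

/-- The class of `x_{ij}` in `B_n`. -/
noncomputable def xcl (k : Type*) [Field k] {n : ℕ} (i j : Fin n) (h : i ≠ j) :
    Bring k n :=
  Ideal.Quotient.mk (Ideal.span (Brels k n)) (xv k i j h)

/-- The weight function giving the `ℕ^n`-grading of `B_n`: `deg (x i j) = e i`. -/
def wB (n : ℕ) : BVarT n → (Fin n → ℕ) := fun q => Pi.single q.val.1 1

/-- The degree-`a` graded component of `B_n`. -/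
noncomputable def BComponent (k : Type*) [Field k] (n : ℕ) (a : Fin n → ℕ) :
    Submodule k (Bring k n) :=
  Submodule.map (Ideal.Quotient.mkₐ k (Ideal.span (Brels k n))).toLinearMap
    (MvPolynomial.weightedHomogeneousSubmodule k (wB n) a)

/-- The variables `a_{ij}` (ordered pairs `i ≠ j`) of the ambient polynomial ring of
`C_{n,1}`. -/
abbrev CVarT (n : ℕ) := {q : Fin n × Fin n // q.1 ≠ q.2}

/-- The variable `a_{ij}`. -/
noncomputable def av (k : Type*) [Field k] {n : ℕ} (i j : Fin n) (h : i ≠ j) :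
    MvPolynomial (CVarT n) k :=
  MvPolynomial.X (⟨(i, j), h⟩ : CVarT n)

/-- The defining relations of `C_{n,1}`. -/
def Crels (k : Type*) [Field k] (n : ℕ) : Set (MvPolynomial (CVarT n) k) :=
  {f | ∃ (i j l : Fin n) (hij : i ≠ j) (hil : i ≠ l) (hjl : j ≠ l),
      f = av k i l hil * av k j l hjl - av k i j hij * av k j l hjl
            - av k j i hij.symm * av k i l hil}

/-- The ring `C_{n,1}`. -/
abbrev Cn1 (k : Type*) [Field k] (n : ℕ) :=
  MvPolynomial (CVarT n) k ⧸ Ideal.span (Crels k n)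

/-- The class of `a_{ij}` in `C_{n,1}`. -/
noncomputable def acl (k : Type*) [Field k] {n : ℕ} (i j : Fin n) (h : i ≠ j) :
    Cn1 k n :=
  Ideal.Quotient.mk (Ideal.span (Crels k n)) (av k i j h)

/-- The weight function giving the `ℕ^n`-grading of `C_{n,1}`: `deg (a i j) = e i`. -/
def wC (n : ℕ) : CVarT n → (Fin n → ℕ) := fun q => Pi.single q.val.1 1

/-- The degree-`a` graded component of `C_{n,1}`. -/
noncomputable def CComponent (k : Type*) [Field k] (n : ℕ) (a : Fin n → ℕ) :
    Submodule k (Cn1 k n) :=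
  Submodule.map (Ideal.Quotient.mkₐ k (Ideal.span (Crels k n))).toLinearMap
    (MvPolynomial.weightedHomogeneousSubmodule k (wC n) a)

section Statement

variable (k : Type*) [Field k] (n : ℕ)

/-- The condition that `ι : B_n → C_{n,1}` sends the class of `x_{ij}` to
`a_{ij} - a_{i,i+1}` (indices mod `n`). -/
def genCond (ι : Bring k n →ₐ[k] Cn1 k n) : Prop :=
  ∀ (i j : Fin n) (h : i ≠ j) (h' : i ≠ nextIdx i),
    ι (xcl k i j h) = acl k i j h - acl k i (nextIdx i) h'

/-- The model graded free module `B_n ⊕ ⨁_{1 ≤ i ≤ n} ⨁_{a ≥ 1} B_n(-a eᵢ)`. -/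
abbrev FreeModel := Bring k n × ((Fin n × ℕ+) →₀ Bring k n)

/-- The degree-`b` graded component of the model module
`B_n ⊕ ⨁_{1 ≤ i ≤ n} ⨁_{a ≥ 1} B_n(-a eᵢ)`: the summand `B_n(-a eᵢ)` contributes its
degree-`(b - a eᵢ)` component when `a ≤ bᵢ`, and `0` otherwise. -/
def FreeModelComponent (b : Fin n → ℕ) : Set (FreeModel k n) :=
  {x | x.1 ∈ BComponent k n b ∧
    ∀ (i : Fin n) (a : ℕ+),
      x.2 (i, a) ∈
        (if (a : ℕ) ≤ b i then
          BComponent k n (fun t => b t - if t = i then (a : ℕ) else 0)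
        else (⊥ : Submodule k (Bring k n)))}

section PuncturedCurve

section Laurent
open HahnSeries

/-- In a ring where every `T - x i j` is invertible with inverse `u j`, the elements
`x j i + c i j / (T - x i j)` satisfy the relations of the universal punctured curve. -/
lemma expansion_relation {σ A : Type*} [CommRing A] (x c : σ → σ → A)
    (hc : ∀ i j l, i ≠ j → i ≠ l → j ≠ l → (x i l - x i j) * (x j l - x j i) = c i j)
    {i j l : σ} (hij : i ≠ j) (hil : i ≠ l) (hjl : j ≠ l) (T : A) (u : σ → A)
    (hu : ∀ m, (T - x i m) * u m = 1) :
    (x j i + c i j * u j - x j l) * (x l i + c i l * u l - x l j) = c j l := by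
  have h1 := hu j
  have h2 := hu l
  rw [← hc i j l hij hil hjl, ← hc i l j hil hij hjl.symm, ← hc j l i hjl hij.symm hil.symm]
  linear_combination (x i l - x i j) * (x j l - x j i) * (x l j - x l i) *
    (u j * h2 - u l * h1)

lemma exists_laurent_expansion {σ R : Type*} [CommRing R] (x c : σ → σ → R)
    (hc : ∀ i j l, i ≠ j → i ≠ l → j ≠ l → (x i l - x i j) * (x j l - x j i) = c i j)
    (hsymm : ∀ i j, i ≠ j → c i j = c j i) (i : σ) :
    ∃ H : σ → LaurentSeries R, H i = single (-1 : ℤ) 1 ∧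
      (∀ j, j ≠ i → ∃ p : PowerSeries R, H j = ofPowerSeries ℤ R p) ∧
      ∀ j l, j ≠ l → (H j - C (x j l)) * (H l - C (x l j)) = C (c j l) := by
  classical
  let v : σ → PowerSeries R := fun j => PowerSeries.X * PowerSeries.mk fun m => x i j ^ m
  have hv : ∀ m, ((single (-1 : ℤ) 1 : LaurentSeries R) - C (x i m)) *
      ofPowerSeries ℤ R (v m) = 1 := by
    intro m
    have h1 : (single (-1 : ℤ) 1 : LaurentSeries R) * ofPowerSeries ℤ R PowerSeries.X = 1 := by
      rw [ofPowerSeries_X, single_mul_single]; simp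
    have h2 : (1 - PowerSeries.C (x i m) * PowerSeries.X) *
        PowerSeries.mk (fun r => x i m ^ r) = 1 := by
      ext r
      rw [sub_mul, one_mul, mul_assoc, map_sub, PowerSeries.coeff_C_mul]
      cases r with
      | zero => simp
      | succ r => simp [PowerSeries.coeff_succ_X_mul, PowerSeries.coeff_one, pow_succ']
    have h3 := congrArg (ofPowerSeries ℤ R) h2
    simp only [map_mul, map_sub, map_one, ofPowerSeries_C] at h3
    simp only [v, map_mul]
    linear_combination h3 + (ofPowerSeries ℤ R (PowerSeries.mk fun r => x i m ^ r)) * h1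
  let P : σ → PowerSeries R := fun j =>
    PowerSeries.C (x j i) + PowerSeries.C (c i j) * v j
  have hP : ∀ j, ofPowerSeries ℤ R (P j) = C (x j i) + C (c i j) * ofPowerSeries ℤ R (v j) := by
    intro j; simp only [P, map_add, map_mul, ofPowerSeries_C]
  refine ⟨fun j => if j = i then single (-1 : ℤ) 1 else ofPowerSeries ℤ R (P j), by simp,
    fun j hj => ⟨P j, by simp [hj]⟩, ?_⟩
  intro j l hjl
  by_cases hj : j = i
  · subst hj
    simp only [if_true, if_neg hjl.symm, hP]
    linear_combination C (c j l) * hv l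
  by_cases hl : l = i
  · subst hl
    simp only [if_true, if_neg hjl, hP, hsymm j l hjl]
    linear_combination C (c l j) * hv j
  simp only [if_neg hj, if_neg hl, hP]
  refine expansion_relation (fun a b => (C (x a b) : LaurentSeries R)) (fun a b => C (c a b)) ?_
    (Ne.symm hj) (Ne.symm hl) hjl (single (-1 : ℤ) 1) (fun j => ofPowerSeries ℤ R (v j)) hv
  intro a b d h1 h2 h3
  simp only [← hc a b d h1 h2 h3, map_mul, map_sub]

/-- Constant Laurent series, as an algebra map over a base ring. -/
noncomputable def laurentC (K R : Type*) [CommRing K] [CommRing R] [Algebra K R] :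
    R →ₐ[K] LaurentSeries R :=
  { (C : R →+* LaurentSeries R) with
    commutes' := fun r => by
      change C _ = _
      rw [algebraMap_apply', PowerSeries.algebraMap_apply, ofPowerSeries_C] }

lemma coeff_ofPowerSeries_neg {R : Type*} [CommRing R] (p : PowerSeries R) (a : ℕ+) :
    (ofPowerSeries ℤ R p).coeff (-(a : ℤ)) = 0 := by
  rw [ofPowerSeries_apply]
  refine embDomain_of_notMem_range ?_
  rintro ⟨m, hm⟩
  have := a.pos
  simp at hm

end Laurent

/-- If multiplication by each `f s` shifts the family `P` by the weight of `s`, then weighted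
homogeneous polynomials in `f` lie in the corresponding members of `P`. -/
lemma aeval_mem_of_isWeightedHomogeneous {K σ M A : Type*} [CommRing K] [AddCommMonoid M]
    [CommRing A] [Algebra K A] (w : σ → M) (P : M → Submodule K A) (f : σ → A)
    (h1 : (1 : A) ∈ P 0) (hf : ∀ s b, ∀ y ∈ P b, f s * y ∈ P (w s + b))
    {b : M} {p : MvPolynomial σ K} (hp : MvPolynomial.IsWeightedHomogeneous w p b) :
    MvPolynomial.aeval f p ∈ P b := by
  have key : ∀ (d : σ →₀ ℕ) (b : M), ∀ y ∈ P b,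
      MvPolynomial.aeval f (MvPolynomial.monomial d (1 : K)) * y ∈ P (Finsupp.weight w d + b) := by
    intro d
    induction d using Finsupp.induction_linear with
    | zero => intro b y hy; simpa using hy
    | add d e hd he =>
      intro b y hy
      have := hd _ _ (he _ _ hy)
      rwa [← mul_assoc, ← add_assoc, ← map_mul, ← map_add, MvPolynomial.monomial_mul,
        one_mul] at this
    | single s m =>
      induction m with
      | zero => intro b y hy; simpa using hy
      | succ m ih =>
        intro b y hy
        have := hf s _ _ (ih b y hy)
        simp only [MvPolynomial.aeval_monomial, Finsupp.weight_single, map_one, one_mul,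
          Finsupp.prod_single_index, pow_zero, pow_succ', mul_assoc, succ_nsmul'] at this ⊢
        rwa [add_assoc]
  rw [p.as_sum, map_sum]
  refine Submodule.sum_mem _ fun d hd => ?_
  have h := key d 0 1 h1
  rw [mul_one, add_zero, hp (MvPolynomial.mem_support_iff.mp hd)] at h
  have h2 : MvPolynomial.monomial d (p.coeff d) =
      p.coeff d • MvPolynomial.monomial d (1 : K) := by
    rw [MvPolynomial.smul_monomial, smul_eq_mul, mul_one]
  rw [h2, map_smul]
  exact Submodule.smul_mem _ _ h

section QuotientGrading

variable {K σ M : Type*} [CommRing K] [AddCommMonoid M] (w : σ → M)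
  (I : Ideal (MvPolynomial σ K))

/-- The image in `MvPolynomial σ K ⧸ I` of the weighted homogeneous polynomials of weight `a`. -/
noncomputable abbrev quotientComponent (a : M) : Submodule K (MvPolynomial σ K ⧸ I) :=
  Submodule.map (Ideal.Quotient.mkₐ K I).toLinearMap
    (MvPolynomial.weightedHomogeneousSubmodule K w a)

variable {w I}

lemma quotientComponent_one_mem : 1 ∈ quotientComponent w I (0 : M) :=
  ⟨1, MvPolynomial.isWeightedHomogeneous_one K w, map_one (Ideal.Quotient.mkₐ K I)⟩

lemma quotientComponent_mul_mem {a b : M} {x y : MvPolynomial σ K ⧸ I}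
    (hx : x ∈ quotientComponent w I a) (hy : y ∈ quotientComponent w I b) :
    x * y ∈ quotientComponent w I (a + b) := by
  obtain ⟨p, hp, rfl⟩ := hx
  obtain ⟨q, hq, rfl⟩ := hy
  exact ⟨p * q, MvPolynomial.IsWeightedHomogeneous.mul hp hq,
    map_mul (Ideal.Quotient.mkₐ K I) p q⟩

lemma quotientComponent_X_mem (s : σ) :
    Ideal.Quotient.mk I (MvPolynomial.X s) ∈ quotientComponent w I (w s) :=
  ⟨_, MvPolynomial.isWeightedHomogeneous_X K w s, rfl⟩

/-- An algebra map out of a quotient of a polynomial ring is determined on homogeneous elements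
by multiplication by the images of the variables. -/
lemma map_mem_of_mem_quotientComponent {A : Type*} [CommRing A] [Algebra K A]
    (F : (MvPolynomial σ K ⧸ I) →ₐ[K] A) (P : M → Submodule K A) (h1 : (1 : A) ∈ P 0)
    (hF : ∀ s b, ∀ y ∈ P b, F (Ideal.Quotient.mk I (MvPolynomial.X s)) * y ∈ P (w s + b))
    {b : M} {x : MvPolynomial σ K ⧸ I} (hx : x ∈ quotientComponent w I b) : F x ∈ P b := by
  obtain ⟨p, hp, rfl⟩ := hx
  have h := aeval_mem_of_isWeightedHomogeneous w P _ h1 hF hp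
  have e : MvPolynomial.aeval (fun s => F (Ideal.Quotient.mk I (MvPolynomial.X s))) =
      F.comp (Ideal.Quotient.mkₐ K I) := by
    ext s; simp
  rw [e] at h
  exact h

lemma quotient_mem_of_quotientComponent_le (N : Submodule K (MvPolynomial σ K ⧸ I))
    (hN : ∀ b, quotientComponent w I b ≤ N) (x : MvPolynomial σ K ⧸ I) : x ∈ N := by
  obtain ⟨p, rfl⟩ := Ideal.Quotient.mk_surjective x
  rw [p.as_sum, map_sum]
  exact Submodule.sum_mem _ fun d _ => hN (Finsupp.weight w d)
    ⟨_, MvPolynomial.isWeightedHomogeneous_monomial w d _ rfl, rfl⟩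

end QuotientGrading

lemma ne_nextIdx {n : ℕ} (hn : 3 ≤ n) (i : Fin n) : i ≠ nextIdx i := by
  intro h
  have h1 : i.val = (i.val + 1) % n := congrArg Fin.val h
  rcases Nat.lt_or_ge (i.val + 1) n with h2 | h2
  · rw [Nat.mod_eq_of_lt h2] at h1; omega
  · have h3 : i.val + 1 = n := by omega
    rw [h3, Nat.mod_self] at h1; omega

lemma exists_ne_ne {n : ℕ} (hn : 3 ≤ n) (i j : Fin n) : ∃ l, i ≠ l ∧ j ≠ l := by
  have : ({i, j} : Finset (Fin n)).card < Fintype.card (Fin n) := by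
    rw [Fintype.card_fin]; exact lt_of_le_of_lt Finset.card_le_two (by omega)
  obtain ⟨l, hl⟩ := Finset.exists_mem_notMem_of_card_lt_card (s := {i, j}) (t := Finset.univ)
    (by simpa using this)
  simp only [Finset.mem_insert, Finset.mem_singleton, not_or] at hl
  exact ⟨l, Ne.symm hl.2.1, Ne.symm hl.2.2⟩

/-- The class of `x_{ij}` in `B_n`, extended by `0` to the diagonal. -/
noncomputable def xB (i j : Fin n) : Bring k n := if h : i ≠ j then xcl k i j h else 0

variable {n}

/-- The product `(x_{il} - x_{ij}) (x_{jl} - x_{ji})`, which does not depend on `l`. -/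
noncomputable def cB (hn : 3 ≤ n) (i j : Fin n) : Bring k n :=
  (xB k n i (exists_ne_ne hn i j).choose - xB k n i j) *
    (xB k n j (exists_ne_ne hn i j).choose - xB k n j i)

variable {k}

lemma xB_of_ne {i j : Fin n} (h : i ≠ j) : xB k n i j = xcl k i j h := dif_pos h

lemma xB_nextIdx (i : Fin n) : xB k n i (nextIdx i) = 0 := by
  unfold xB
  split_ifs with h
  · exact Ideal.Quotient.eq_zero_iff_mem.mpr (Ideal.subset_span (Or.inr ⟨i, h, rfl⟩))
  · rfl

lemma xB_relation (i j l m : Fin n) (hij : i ≠ j) (hil : i ≠ l) (him : i ≠ m) (hjl : j ≠ l)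
    (hjm : j ≠ m) :
    (xB k n i l - xB k n i j) * (xB k n j l - xB k n j i) =
      (xB k n i m - xB k n i j) * (xB k n j m - xB k n j i) := by
  by_cases hlm : l = m
  · rw [hlm]
  rw [← sub_eq_zero]
  simp only [xB_of_ne hij, xB_of_ne hij.symm, xB_of_ne hil, xB_of_ne him, xB_of_ne hjl,
    xB_of_ne hjm]
  exact Ideal.Quotient.eq_zero_iff_mem.mpr (Ideal.subset_span
    (Or.inl ⟨i, j, l, m, hij, hil, him, hjl, hjm, hlm, rfl⟩))

lemma cB_eq (hn : 3 ≤ n) (i j l : Fin n) (hij : i ≠ j) (hil : i ≠ l) (hjl : j ≠ l) :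
    (xB k n i l - xB k n i j) * (xB k n j l - xB k n j i) = cB k hn i j :=
  xB_relation i j l _ hij hil (exists_ne_ne hn i j).choose_spec.1 hjl
    (exists_ne_ne hn i j).choose_spec.2

lemma cB_comm (hn : 3 ≤ n) (i j : Fin n) (hij : i ≠ j) : cB k hn i j = cB k hn j i := by
  obtain ⟨l, hil, hjl⟩ := exists_ne_ne hn i j
  rw [← cB_eq hn i j l hij hil hjl, ← cB_eq hn j i l hij.symm hjl hil, mul_comm]

lemma xB_mem (i j : Fin n) : xB k n i j ∈ BComponent k n (Pi.single i 1) := by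
  unfold xB
  split_ifs with h
  · exact quotientComponent_X_mem (w := wB n) (⟨(i, j), h⟩ : BVarT n)
  · exact zero_mem _

lemma cB_mem (hn : 3 ≤ n) (i j : Fin n) :
    cB k hn i j ∈ BComponent k n (Pi.single i 1 + Pi.single j 1) :=
  quotientComponent_mul_mem (sub_mem (xB_mem _ _) (xB_mem _ _))
    (sub_mem (xB_mem _ _) (xB_mem _ _))

lemma acl_relation (i j l : Fin n) (hij : i ≠ j) (hil : i ≠ l) (hjl : j ≠ l) :
    acl k i l hil * acl k j l hjl - acl k i j hij * acl k j l hjl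
      - acl k j i hij.symm * acl k i l hil = 0 :=
  Ideal.Quotient.eq_zero_iff_mem.mpr (Ideal.subset_span ⟨i, j, l, hij, hil, hjl, rfl⟩)

lemma Cn1_algHom_ext {A : Type*} [CommRing A] [Algebra k A] {F G : Cn1 k n →ₐ[k] A}
    (h : ∀ i j h, F (acl k i j h) = G (acl k i j h)) : F = G := by
  refine Ideal.Quotient.algHom_ext _ (MvPolynomial.algHom_ext ?_)
  rintro ⟨⟨i, j⟩, hij⟩
  exact h i j hij

lemma Bring_algHom_ext {A : Type*} [CommRing A] [Algebra k A] {F G : Bring k n →ₐ[k] A}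
    (h : ∀ i j h, F (xcl k i j h) = G (xcl k i j h)) : F = G := by
  refine Ideal.Quotient.algHom_ext _ (MvPolynomial.algHom_ext ?_)
  rintro ⟨⟨i, j⟩, hij⟩
  exact h i j hij

lemma exists_algHom_Cn1 {A : Type*} [CommRing A] [Algebra k A] (f : Fin n → Fin n → A)
    (hf : ∀ i j l, i ≠ j → i ≠ l → j ≠ l →
      f i l * f j l - f i j * f j l - f j i * f i l = 0) :
    ∃ F : Cn1 k n →ₐ[k] A, ∀ i j h, F (acl k i j h) = f i j := by
  refine ⟨Ideal.Quotient.liftₐ _ (MvPolynomial.aeval fun s => f s.1.1 s.1.2) ?_, ?_⟩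
  · intro p hp
    induction hp using Submodule.span_induction with
    | mem p hp =>
      obtain ⟨i, j, l, hij, hil, hjl, rfl⟩ := hp
      simpa [av] using hf i j l hij hil hjl
    | zero => simp
    | add p q _ _ hp hq => rw [map_add, hp, hq, add_zero]
    | smul r p _ hp => rw [smul_eq_mul, map_mul, hp, mul_zero]
  · intro i j h
    exact MvPolynomial.aeval_X _ _

lemma exists_genCond (hn : 3 ≤ n) : ∃ ι : Bring k n →ₐ[k] Cn1 k n, genCond k n ι := by
  refine ⟨Ideal.Quotient.liftₐ _ (MvPolynomial.aeval fun s =>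
    acl k s.1.1 s.1.2 s.2 - acl k s.1.1 (nextIdx s.1.1) (ne_nextIdx hn _)) ?_, ?_⟩
  · intro p hp
    induction hp using Submodule.span_induction with
    | mem p hp =>
      rcases hp with ⟨i, j, l, m, hij, hil, him, hjl, hjm, hlm, rfl⟩ | ⟨i, h, rfl⟩
      · have h1 := acl_relation (k := k) i j l hij hil hjl
        have h2 := acl_relation (k := k) i j m hij him hjm
        simp only [xv, map_sub, map_mul, MvPolynomial.aeval_X]
        linear_combination h1 - h2
      · simp [xv]
    | zero => simp
    | add p q _ _ hp hq => rw [map_add, hp, hq, add_zero]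
    | smul r p _ hp => rw [smul_eq_mul, map_mul, hp, mul_zero]
  · intro i j h h'
    exact MvPolynomial.aeval_X _ _

lemma genCond_unique (hn : 3 ≤ n) {ι κ : Bring k n →ₐ[k] Cn1 k n} (hι : genCond k n ι)
    (hκ : genCond k n κ) : ι = κ :=
  Bring_algHom_ext fun i j h => by
    rw [hι i j h (ne_nextIdx hn i), hκ i j h (ne_nextIdx hn i)]

variable (k) in
/-- The element `-a_{i,i+1}` of `C_{n,1}`, with powers completing `1` to a basis over `B_n`. -/
noncomputable def hC (hn : 3 ≤ n) (i : Fin n) : Cn1 k n := -acl k i (nextIdx i) (ne_nextIdx hn i)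

lemma hC_mem (hn : 3 ≤ n) (i : Fin n) : hC k hn i ∈ CComponent k n (Pi.single i 1) :=
  neg_mem (quotientComponent_X_mem (w := wC n) (⟨(i, nextIdx i), ne_nextIdx hn i⟩ : CVarT n))

lemma hC_pow_mem (hn : 3 ≤ n) (i : Fin n) (m : ℕ) :
    hC k hn i ^ m ∈ CComponent k n (Pi.single i m) := by
  induction m with
  | zero =>
    rw [pow_zero, Pi.single_zero]
    exact quotientComponent_one_mem (w := wC n)
  | succ m ih =>
    rw [pow_succ, Pi.single_add]
    exact quotientComponent_mul_mem ih (hC_mem hn i)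

section Structure

variable {ι : Bring k n →ₐ[k] Cn1 k n} (hn : 3 ≤ n)

lemma map_xB (hι : genCond k n ι) {i j : Fin n} (h : i ≠ j) :
    ι (xB k n i j) = acl k i j h + hC k hn i := by
  rw [xB_of_ne h, hι i j h (ne_nextIdx hn i), hC, sub_eq_add_neg]

lemma map_mem_CComponent (hι : genCond k n ι) (hn : 3 ≤ n) {b : Fin n → ℕ} {x : Bring k n}
    (hx : x ∈ BComponent k n b) : ι x ∈ CComponent k n b := by
  refine map_mem_of_mem_quotientComponent ι (CComponent k n)
    (quotientComponent_one_mem (w := wC n)) ?_ hx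
  rintro ⟨⟨i, j⟩, h⟩ b y hy
  have e : ι (Ideal.Quotient.mk _ (MvPolynomial.X (⟨(i, j), h⟩ : BVarT n))) =
      acl k i j h - acl k i (nextIdx i) (ne_nextIdx hn i) := hι i j h (ne_nextIdx hn i)
  rw [e]
  exact quotientComponent_mul_mem (w := wC n) (sub_mem
    (quotientComponent_X_mem (w := wC n) (⟨(i, j), h⟩ : CVarT n))
    (quotientComponent_X_mem (w := wC n) (⟨(i, nextIdx i), ne_nextIdx hn i⟩ : CVarT n))) hy

lemma hC_mul_hC (hι : genCond k n ι) {i j : Fin n} (hij : i ≠ j) :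
    (hC k hn i - ι (xB k n i j)) * (hC k hn j - ι (xB k n j i)) = ι (cB k hn i j) := by
  obtain ⟨l, hil, hjl⟩ := exists_ne_ne hn i j
  rw [← cB_eq hn i j l hij hil hjl]
  simp only [map_mul, map_sub, map_xB hn hι hij, map_xB hn hι hij.symm, map_xB hn hι hil,
    map_xB hn hι hjl]
  linear_combination -acl_relation (k := k) i j l hij hil hjl

end Structure

/-- The span of the products of homogeneous elements of `B_n` with powers of the `hC i` that
have total degree `b`. -/
noncomputable def powerSpan (hn : 3 ≤ n) (ι : Bring k n →ₐ[k] Cn1 k n) (b : Fin n → ℕ) :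
    Submodule k (Cn1 k n) :=
  Submodule.span k {y | ∃ (d : Fin n → ℕ) (j : Fin n) (m : ℕ), d + Pi.single j m = b ∧
    ∃ β ∈ BComponent k n d, y = ι β * hC k hn j ^ m}

section PowerSpan

variable {ι : Bring k n →ₐ[k] Cn1 k n} (hn : 3 ≤ n)

lemma mul_mem_powerSpan {d : Fin n → ℕ} {β : Bring k n} (hβ : β ∈ BComponent k n d) (j : Fin n)
    (m : ℕ) : ι β * hC k hn j ^ m ∈ powerSpan hn ι (d + Pi.single j m) :=
  Submodule.subset_span ⟨d, j, m, rfl, β, hβ, rfl⟩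

lemma hC_pow_mem_powerSpan (j : Fin n) (m : ℕ) :
    hC k hn j ^ m ∈ powerSpan hn ι (Pi.single j m) := by
  simpa using mul_mem_powerSpan (ι := ι) hn (quotientComponent_one_mem (w := wB n)) j m

lemma map_mul_mem_powerSpan {c b : Fin n → ℕ} {β : Bring k n} {y : Cn1 k n}
    (hβ : β ∈ BComponent k n c) (hy : y ∈ powerSpan hn ι b) :
    ι β * y ∈ powerSpan hn ι (c + b) := by
  induction hy using Submodule.span_induction with
  | mem y hy =>
    obtain ⟨d, j, m, rfl, γ, hγ, rfl⟩ := hy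
    rw [← mul_assoc, ← map_mul, ← add_assoc]
    exact mul_mem_powerSpan hn (quotientComponent_mul_mem (w := wB n) hβ hγ) j m
  | zero => rw [mul_zero]; exact zero_mem _
  | add y z _ _ hy hz => rw [mul_add]; exact add_mem hy hz
  | smul r y _ hy => rw [mul_smul_comm]; exact Submodule.smul_mem _ _ hy

lemma hC_mul_pow_mem_powerSpan (hι : genCond k n ι) (i j : Fin n) (m : ℕ) :
    hC k hn i * hC k hn j ^ m ∈ powerSpan hn ι (Pi.single i 1 + Pi.single j m) := by
  by_cases hij : i = j
  · subst hij
    rw [← pow_succ', ← Pi.single_add, add_comm 1 m]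
    exact hC_pow_mem_powerSpan hn i (m + 1)
  induction m with
  | zero => simpa using hC_pow_mem_powerSpan (ι := ι) hn i 1
  | succ m ih =>
    have e : hC k hn i * hC k hn j ^ (m + 1) =
        ι (xB k n j i) * (hC k hn i * hC k hn j ^ m) + ι (xB k n i j) * hC k hn j ^ (m + 1) +
          ι (cB k hn i j - xB k n i j * xB k n j i) * hC k hn j ^ m := by
      rw [map_sub, map_mul, ← hC_mul_hC hn hι hij]; ring
    have hs : (Pi.single j (m + 1) : Fin n → ℕ) = Pi.single j 1 + Pi.single j m := by
      rw [← Pi.single_add, add_comm]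
    rw [e]
    refine add_mem (add_mem ?_ ?_) ?_
    · rw [hs, add_left_comm]
      exact map_mul_mem_powerSpan hn (xB_mem _ _) ih
    · exact mul_mem_powerSpan hn (xB_mem _ _) j (m + 1)
    · rw [hs, ← add_assoc]
      exact mul_mem_powerSpan hn (sub_mem (cB_mem hn i j)
        (quotientComponent_mul_mem (w := wB n) (xB_mem i j) (xB_mem j i))) j m

lemma hC_mul_mem_powerSpan (hι : genCond k n ι) (i : Fin n) {b : Fin n → ℕ} {y : Cn1 k n}
    (hy : y ∈ powerSpan hn ι b) : hC k hn i * y ∈ powerSpan hn ι (Pi.single i 1 + b) := by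
  induction hy using Submodule.span_induction with
  | mem y hy =>
    obtain ⟨d, j, m, rfl, γ, hγ, rfl⟩ := hy
    rw [mul_left_comm, add_left_comm]
    exact map_mul_mem_powerSpan hn hγ (hC_mul_pow_mem_powerSpan hn hι i j m)
  | zero => rw [mul_zero]; exact zero_mem _
  | add y z _ _ hy hz => rw [mul_add]; exact add_mem hy hz
  | smul r y _ hy => rw [mul_smul_comm]; exact Submodule.smul_mem _ _ hy

lemma CComponent_le_powerSpan (hι : genCond k n ι) (b : Fin n → ℕ) :
    CComponent k n b ≤ powerSpan hn ι b := by
  intro x hx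
  refine map_mem_of_mem_quotientComponent (AlgHom.id k (Cn1 k n)) (powerSpan hn ι) ?_ ?_ hx
  · simpa using hC_pow_mem_powerSpan (ι := ι) hn (⟨0, by omega⟩ : Fin n) 0
  · rintro ⟨⟨i, j⟩, h⟩ b y hy
    have e : AlgHom.id k (Cn1 k n)
        (Ideal.Quotient.mk _ (MvPolynomial.X (⟨(i, j), h⟩ : CVarT n))) =
        ι (xB k n i j) - hC k hn i := by
      rw [map_xB hn hι h, add_sub_cancel_right]; rfl
    rw [e, sub_mul]
    exact sub_mem (map_mul_mem_powerSpan hn (xB_mem i j) hy) (hC_mul_mem_powerSpan hn hι i hy)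

end PowerSpan

/-- The `B_n`-linear map from the model module to `C_{n,1}` that sends the generators to `1` and
to the powers of the `hC i`, as a `k`-linear map. -/
noncomputable def freeMap (hn : 3 ≤ n) (ι : Bring k n →ₐ[k] Cn1 k n) :
    FreeModel k n →ₗ[k] Cn1 k n :=
  LinearMap.coprod ι.toLinearMap (Finsupp.lsum k fun p : Fin n × ℕ+ =>
    (LinearMap.mulRight k (hC k hn p.1 ^ (p.2 : ℕ))).comp ι.toLinearMap)

section FreeMap

variable {ι : Bring k n →ₐ[k] Cn1 k n} (hn : 3 ≤ n)

lemma freeMap_apply (x : FreeModel k n) : freeMap hn ι x =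
    ι x.1 + x.2.sum fun p β => ι β * hC k hn p.1 ^ (p.2 : ℕ) := rfl

lemma freeMap_smul (r : Bring k n) (x : FreeModel k n) :
    freeMap hn ι (r • x) = ι r * freeMap hn ι x := by
  rw [freeMap_apply, freeMap_apply, Prod.smul_fst, Prod.smul_snd,
    Finsupp.sum_smul_index (by simp), smul_eq_mul, map_mul, mul_add, Finsupp.mul_sum]
  simp only [map_mul, mul_assoc]

lemma freeModelComponent_fst_mem {b : Fin n → ℕ} {β : Bring k n} (hβ : β ∈ BComponent k n b) :
    ((β, 0) : FreeModel k n) ∈ FreeModelComponent k n b :=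
  ⟨hβ, fun _ _ => zero_mem _⟩

lemma freeModelComponent_single_mem {d : Fin n → ℕ} {β : Bring k n}
    (hβ : β ∈ BComponent k n d) (j : Fin n) (m : ℕ+) :
    ((0, Finsupp.single (j, m) β) : FreeModel k n) ∈
      FreeModelComponent k n (d + Pi.single j (m : ℕ)) := by
  refine ⟨zero_mem _, fun i a => ?_⟩
  by_cases h : (j, m) = (i, a)
  · obtain ⟨rfl, rfl⟩ := Prod.mk.inj h
    have e : (fun t => (d + Pi.single j (m : ℕ) : Fin n → ℕ) t - if t = j then (m : ℕ) else 0)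
        = d := by
      funext t
      by_cases ht : t = j
      · subst ht; simp
      · simp [ht]
    rw [if_pos (by simp), e]
    simpa using hβ
  · simp only [Finsupp.single_eq_of_ne (Ne.symm h)]
    exact zero_mem _

lemma powerSpan_subset_image (b : Fin n → ℕ) {y : Cn1 k n} (hy : y ∈ powerSpan hn ι b) :
    ∃ x ∈ FreeModelComponent k n b, freeMap hn ι x = y := by
  induction hy using Submodule.span_induction with
  | mem y hy =>
    obtain ⟨d, j, m, rfl, β, hβ, rfl⟩ := hy
    rcases Nat.eq_zero_or_pos m with rfl | hm
    · refine ⟨(β, 0), ?_, by simp [freeMap_apply]⟩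
      simpa using freeModelComponent_fst_mem hβ
    · exact ⟨_, freeModelComponent_single_mem hβ j ⟨m, hm⟩, by simp [freeMap_apply]⟩
  | zero => exact ⟨0, ⟨zero_mem _, fun _ _ => zero_mem _⟩, map_zero _⟩
  | add y z _ _ hy hz =>
    obtain ⟨u, hu, rfl⟩ := hy
    obtain ⟨v, hv, rfl⟩ := hz
    exact ⟨u + v, ⟨add_mem hu.1 hv.1, fun i a => add_mem (hu.2 i a) (hv.2 i a)⟩, map_add _ _ _⟩
  | smul r y _ hy =>
    obtain ⟨u, hu, rfl⟩ := hy
    refine ⟨r • u, ⟨Submodule.smul_mem _ r hu.1, fun i a => ?_⟩, map_smul _ _ _⟩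
    have h := hu.2 i a
    split_ifs at h ⊢ with h'
    · exact Submodule.smul_mem _ r h
    · exact Submodule.smul_mem _ r h

lemma freeMap_mem_CComponent (hι : genCond k n ι) {b : Fin n → ℕ} {x : FreeModel k n}
    (hx : x ∈ FreeModelComponent k n b) : freeMap hn ι x ∈ CComponent k n b := by
  rw [freeMap_apply]
  refine add_mem (map_mem_CComponent hι hn hx.1) (Submodule.sum_mem _ ?_)
  rintro ⟨i, a⟩ -
  have h := hx.2 i a
  split_ifs at h with hab
  · have e : (fun t => b t - if t = i then (a : ℕ) else 0) + Pi.single i (a : ℕ) = b := by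
      funext t
      by_cases ht : t = i
      · subst ht; simpa using Nat.sub_add_cancel hab
      · simp [ht]
    have := quotientComponent_mul_mem (w := wC n) (map_mem_CComponent hι hn h)
      (hC_pow_mem hn i (a : ℕ))
    rwa [e] at this
  · rw [Submodule.mem_bot] at h
    simp only [h, map_zero, zero_mul]
    exact zero_mem _

lemma freeMap_image (hι : genCond k n ι) (b : Fin n → ℕ) :
    freeMap hn ι '' FreeModelComponent k n b = (CComponent k n b : Set (Cn1 k n)) := by
  ext y
  constructor
  · rintro ⟨x, hx, rfl⟩
    exact freeMap_mem_CComponent hn hι hx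
  · intro hy
    exact powerSpan_subset_image hn b (CComponent_le_powerSpan hn hι b hy)

lemma freeMap_surjective (hι : genCond k n ι) : Function.Surjective (freeMap hn ι) := by
  intro y
  refine quotient_mem_of_quotientComponent_le (w := wC n) (LinearMap.range (freeMap hn ι)) ?_ y
  intro b z hz
  obtain ⟨x, -, hx⟩ := powerSpan_subset_image hn b (CComponent_le_powerSpan hn hι b hz)
  exact ⟨x, hx⟩

/-- The expansion of `C_{n,1}` in Laurent series over `B_n` at the `i`-th puncture. -/
lemma exists_laurent_ringHom (hι : genCond k n ι) (i : Fin n) :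
    ∃ φ : Cn1 k n →+* LaurentSeries (Bring k n),
      (∀ β, φ (ι β) = HahnSeries.C β) ∧
      φ (hC k hn i) = HahnSeries.single (-1 : ℤ) 1 ∧
      ∀ j, j ≠ i → ∃ p : PowerSeries (Bring k n),
        φ (hC k hn j) = HahnSeries.ofPowerSeries ℤ (Bring k n) p := by
  obtain ⟨H, hi, hH, hrel⟩ := exists_laurent_expansion (xB k n) (cB k hn) (cB_eq hn)
    (cB_comm hn) i
  obtain ⟨φ, hφ⟩ := exists_algHom_Cn1 (k := k) (n := n)
    (fun j l => HahnSeries.C (xB k n j l) - H j) (by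
      intro j l m hjl hjm hlm
      have h := hrel j l hjl
      rw [← cB_eq hn j l m hjl hjm hlm] at h
      simp only [map_mul, map_sub] at h
      linear_combination -h)
  have hφh : ∀ j, φ (hC k hn j) = H j := by
    intro j
    rw [hC, map_neg, hφ, xB_nextIdx, map_zero, zero_sub, neg_neg]
  have hφι : φ.comp ι = laurentC k (Bring k n) := by
    refine Bring_algHom_ext (F := φ.comp ι) (G := laurentC k (Bring k n)) fun j l h => ?_
    rw [AlgHom.comp_apply, ← xB_of_ne h, map_xB hn hι h, map_add, hφ, hφh, sub_add_cancel]
    rfl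
  refine ⟨φ.toRingHom, fun β => DFunLike.congr_fun hφι β, (hφh i).trans hi, fun j hj => ?_⟩
  obtain ⟨p, hp⟩ := hH j hj
  exact ⟨p, (hφh j).trans hp⟩

lemma snd_eq_zero_of_freeMap_eq_zero (hι : genCond k n ι) {x : FreeModel k n}
    (hx : freeMap hn ι x = 0) :
    x.2 = 0 := by
  classical
  ext ⟨i, a⟩
  obtain ⟨φ, hφ, hi, hj⟩ := exists_laurent_ringHom hn hι i
  have h := congrArg (fun y => (φ y).coeff (-((a : ℕ) : ℤ))) hx
  have h0 : (HahnSeries.C x.1 : LaurentSeries (Bring k n)).coeff (-((a : ℕ) : ℤ)) = 0 := by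
    rw [← HahnSeries.ofPowerSeries_C]
    exact coeff_ofPowerSeries_neg _ a
  have h1 : ∀ p : Fin n × ℕ+, (φ (ι (x.2 p) * hC k hn p.1 ^ (p.2 : ℕ))).coeff (-((a : ℕ) : ℤ)) =
      if p = (i, a) then x.2 p else 0 := by
    rintro ⟨j, m⟩
    rw [map_mul, map_pow, hφ]
    by_cases hji : j = i
    · subst hji
      rw [hi, HahnSeries.single_pow, HahnSeries.C_apply, HahnSeries.single_mul_single,
        HahnSeries.coeff_single]
      by_cases hm : m = a
      · subst hm; simp
      · have : (m : ℕ) ≠ a := fun e => hm (PNat.coe_injective e)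
        rw [if_neg (by simp only [nsmul_eq_mul, zero_add]; omega), if_neg (by simpa using hm)]
    · obtain ⟨p, hp⟩ := hj j hji
      rw [hp, ← HahnSeries.ofPowerSeries_C, ← map_pow, ← map_mul, coeff_ofPowerSeries_neg,
        if_neg (by simp [hji])]
  rw [freeMap_apply] at h
  simp only [map_add, hφ, HahnSeries.coeff_add, h0, zero_add, Finsupp.sum, map_sum,
    HahnSeries.coeff_sum, h1, map_zero, HahnSeries.coeff_zero] at h
  rw [Finset.sum_ite_eq'] at h
  simpa using h

lemma genCond_injective (hι : genCond k n ι) (hn : 3 ≤ n) : Function.Injective ι := by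
  obtain ⟨φ, hφ, -⟩ := exists_laurent_ringHom hn hι ⟨0, by omega⟩
  intro a b hab
  have h := congrArg φ hab
  rw [hφ, hφ] at h
  exact HahnSeries.C_injective h

lemma freeMap_injective (hι : genCond k n ι) : Function.Injective (freeMap hn ι) := by
  rw [injective_iff_map_eq_zero]
  intro x hx
  have h2 := snd_eq_zero_of_freeMap_eq_zero hn hι hx
  rw [freeMap_apply, h2, Finsupp.sum_zero_index, add_zero] at hx
  exact Prod.ext ((map_eq_zero_iff ι (genCond_injective hι hn)).mp hx) h2

end FreeMap

/-- A bijective additive map that is semilinear along `f : B →+* C` is a linear equivalence for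
the `B`-module structure on `C` given by `f`, which is free when the source is. -/
lemma exists_linearEquiv_compHom {B C M : Type*} [CommRing B] [CommRing C] [AddCommMonoid M]
    [Module B M] [Module.Free B M] (f : B →+* C) (g : M → C) (hadd : ∀ x y, g (x + y) = g x + g y)
    (hsmul : ∀ (r : B) (x : M), g (r • x) = f r * g x) (hbij : Function.Bijective g) :
    letI : Module B C := Module.compHom C f
    ∃ e : M ≃ₗ[B] C, ⇑e = g ∧ Module.Free B C := by
  let : Module B C := Module.compHom C f
  let e : M ≃ₗ[B] C := LinearEquiv.ofBijective
    { toFun := g, map_add' := hadd, map_smul' := hsmul } hbij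
  exact ⟨e, rfl, Module.Free.of_equiv e⟩

end PuncturedCurve

set_option synthInstance.maxHeartbeats 1000000 in
set_option maxHeartbeats 1000000 in
/-- Lemma 3.3 and equation (2.4) of the paper: for `n ≥ 3` there is a
unique `k`-algebra homomorphism `ι : B_n → C_{n,1}` with `ι(x̄_{ij}) = a_{ij} - a_{i,i+1}`
(indices mod `n`); it is injective and grading-preserving, and `C_{n,1}`, viewed as a
`ℤⁿ`-graded `B_n`-module via `ι`, is isomorphic to
`B_n ⊕ ⨁_{1 ≤ i ≤ n} ⨁_{a ≥ 1} B_n(-a eᵢ)`; in particular it is a free `B_n`-module. -/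
theorem Bn_to_Cn1 (hn : 3 ≤ n) :
    (∃! ι : Bring k n →ₐ[k] Cn1 k n, genCond k n ι) ∧
    ∀ ι : Bring k n →ₐ[k] Cn1 k n, genCond k n ι →
      Function.Injective ι ∧
      (∀ (b : Fin n → ℕ), ∀ x ∈ BComponent k n b, ι x ∈ CComponent k n b) ∧
      (letI : Module (Bring k n) (Cn1 k n) := Module.compHom _ ι.toRingHom
        ∃ g : FreeModel k n ≃ₗ[Bring k n] Cn1 k n,
          (∀ b : Fin n → ℕ,
            g '' FreeModelComponent k n b = (CComponent k n b : Set (Cn1 k n))) ∧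
          Module.Free (Bring k n) (Cn1 k n)) := by
  refine ⟨?_, fun ι hι => ⟨genCond_injective hι hn,
    fun b x hx => map_mem_CComponent hι hn hx, ?_⟩⟩
  · obtain ⟨ι, hι⟩ := exists_genCond (k := k) hn
    exact ⟨ι, hι, fun κ hκ => genCond_unique hn hκ hι⟩
  · obtain ⟨g, hg, hfree⟩ := exists_linearEquiv_compHom (B := Bring k n) (C := Cn1 k n)
      (M := FreeModel k n) ι.toRingHom (freeMap hn ι)
      (fun x y => map_add (freeMap hn ι) x y) (fun r x => freeMap_smul hn r x)
      ⟨freeMap_injective hn hι, freeMap_surjective hn hι⟩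
    refine ⟨g, fun b => ?_, hfree⟩
    rw [hg]
    exact freeMap_image hn hι b

end Statement
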